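/- Let M ∈ [0,1) and define ρ(x) = √(x₁² + (1−M²)x₂²)/(1−M²) for x = (x₁,x₂) ∈ ℝ². Let Ω_b ⊂ ℝ² be a bounded measurable set and let ε ∈ (0,1). Then there exists a constant C > 0 (depending on Ω_b, M and ε) such that for all y, z ∈ Ω_b, ∫_{Ω_b} |ln ρ(x−y) − ln ρ(x−z)|² dx ≤ C |y − z|^{2−ε}, where the integral is with respect to two-dimensional Lebesgue measure and |·| denotes the Euclidean norm. -/

import Mathlib

open MeasureTheory

theorem Real.log_one_add_le_rpow_div {t θ : ℝ} (ht : 0 ≤ t) (hθ0 : 0 < θ) (hθ1 : θ ≤ 1) :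
    Real.log (1 + t) ≤ t ^ θ / θ := by
  have h1 : Real.log ((1 + t) ^ θ) ≤ t ^ θ := by
    have h2 : (1 + t) ^ θ ≤ 1 + t ^ θ := by
      simpa using Real.rpow_add_le_add_rpow zero_le_one ht hθ0.le hθ1
    have h3 : 0 < (1 + t) ^ θ := by positivity
    linarith [Real.log_le_sub_one_of_pos h3]
  rw [Real.log_rpow (by positivity)] at h1
  rw [le_div_iff₀ hθ0]
  linarith

theorem Real.log_sub_log_le_rpow_div {a b m δ θ : ℝ} (hm : 0 < m) (ha : 0 < a) (hb : m ≤ b)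
    (hδ0 : 0 ≤ δ) (hδ : a - b ≤ δ) (hθ0 : 0 < θ) (hθ1 : θ ≤ 1) :
    Real.log a - Real.log b ≤ (δ / m) ^ θ / θ := by
  have hb0 : 0 < b := hm.trans_le hb
  have hab : a / b ≤ 1 + δ / m := by
    have h1 : a / b ≤ 1 + δ / b := by
      rw [div_le_iff₀ hb0, add_mul, div_mul_cancel₀ _ hb0.ne']
      linarith
    have h2 : δ / b ≤ δ / m := by gcongr
    linarith
  rw [← Real.log_div ha.ne' hb0.ne']
  exact (Real.log_le_log (by positivity) hab).trans
    (Real.log_one_add_le_rpow_div (by positivity) hθ0 hθ1)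

theorem Real.abs_log_sub_log_sq_le {a b u v δ p : ℝ} (hu : 0 < u) (hv : 0 < v) (ha : u ≤ a)
    (hb : v ≤ b) (hδ : |a - b| ≤ δ) (hp0 : 0 < p) (hp2 : p ≤ 2) :
    |Real.log a - Real.log b| ^ 2 ≤ 4 / p ^ 2 * δ ^ p * (u ^ (-p) + v ^ (-p)) := by
  have hδ0 : 0 ≤ δ := (abs_nonneg _).trans hδ
  have sq_bound : ∀ m : ℝ, 0 < m → ((δ / m) ^ (p / 2) / (p / 2)) ^ 2 =
      4 / p ^ 2 * δ ^ p * m ^ (-p) := by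
    intro m hm
    rw [div_pow, ← Real.rpow_mul_natCast (by positivity), Real.div_rpow hδ0 hm.le,
      Real.rpow_neg hm.le]
    have : p / 2 * ((2 : ℕ) : ℝ) = p := by push_cast; ring
    rw [this]
    field_simp
    norm_num
  have hδ' := abs_le.mp hδ
  rcases le_total (Real.log b) (Real.log a) with h | h
  · rw [abs_of_nonneg (sub_nonneg.mpr h)]
    calc _ ≤ ((δ / v) ^ (p / 2) / (p / 2)) ^ 2 :=
          pow_le_pow_left₀ (sub_nonneg.mpr h) (Real.log_sub_log_le_rpow_div hv (hu.trans_le ha) hb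
            hδ0 hδ'.2 (by positivity) (by linarith)) 2
      _ = _ := sq_bound v hv
      _ ≤ _ := by
        gcongr
        linarith [Real.rpow_nonneg hu.le (-p)]
  · rw [abs_sub_comm, abs_of_nonneg (sub_nonneg.mpr h)]
    calc _ ≤ ((δ / u) ^ (p / 2) / (p / 2)) ^ 2 :=
          pow_le_pow_left₀ (sub_nonneg.mpr h) (Real.log_sub_log_le_rpow_div hu (hv.trans_le hb) ha
            hδ0 (by linarith) (by positivity) (by linarith)) 2
      _ = _ := sq_bound u hu
      _ ≤ _ := by
        gcongr
        linarith [Real.rpow_nonneg hv.le (-p)]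

theorem integrable_indicator_ball_norm_rpow_neg (R : ℝ) {p : ℝ} (hp : p < 2) :
    Integrable ((Metric.ball (0 : EuclideanSpace ℝ (Fin 2)) R).indicator
      fun x => ‖x‖ ^ (-p)) := by
  have h : Integrable (fun x : EuclideanSpace ℝ (Fin 2) =>
      (Set.Iio R).indicator (fun r : ℝ => r ^ (-p)) ‖x‖) := by
    rw [integrable_fun_norm_addHaar volume (f := (Set.Iio R).indicator fun r : ℝ => r ^ (-p))]
    have h1 : IntegrableOn (fun r : ℝ => r ^ (1 - p)) (Set.Ioo 0 R) :=
      (intervalIntegral.intervalIntegrable_rpow' (by linarith)).1.mono_set Set.Ioo_subset_Ioc_self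
    have h2 : IntegrableOn ((Set.Iio R).indicator fun r : ℝ => r ^ (1 - p)) (Set.Ioi 0) := by
      rw [IntegrableOn, integrable_indicator_iff measurableSet_Iio, IntegrableOn,
        Measure.restrict_restrict measurableSet_Iio, Set.inter_comm, Set.Ioi_inter_Iio]
      exact h1
    refine h2.congr_fun (fun r hr => ?_) measurableSet_Ioi
    have hr : 0 < r := hr
    by_cases hR : r < R
    · simp [hR, Real.rpow_sub hr, Real.rpow_neg hr.le, div_eq_mul_inv]
    · simp [hR]
  refine h.congr (.of_forall fun x => ?_)
  by_cases hx : ‖x‖ < R <;> simp [hx]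

/-- The anisotropic norm is `‖L x‖ / k` for the linear map `L x = (x₀, √k x₁)`. -/
theorem abs_sqrt_div_sub_sqrt_div_le {k : ℝ} (hk0 : 0 < k) (hk1 : k ≤ 1)
    (x y : EuclideanSpace ℝ (Fin 2)) :
    |√((x 0) ^ 2 + k * (x 1) ^ 2) / k - √((y 0) ^ 2 + k * (y 1) ^ 2) / k| ≤ ‖x - y‖ / k := by
  have hL : ∀ w : EuclideanSpace ℝ (Fin 2),
      √((w 0) ^ 2 + k * (w 1) ^ 2) = ‖!₂[w 0, √k * w 1]‖ := by
    intro w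
    simp [EuclideanSpace.norm_eq, Fin.sum_univ_two, mul_pow, Real.sq_sqrt hk0.le]
  have hsub : !₂[x 0, √k * x 1] - !₂[y 0, √k * y 1] = !₂[(x - y) 0, √k * (x - y) 1] := by
    ext i
    fin_cases i <;> simp [mul_sub]
  rw [← sub_div, abs_div, abs_of_pos hk0]
  gcongr
  rw [hL, hL]
  refine (abs_norm_sub_norm_le _ _).trans ?_
  rw [hsub, ← hL, EuclideanSpace.norm_eq, Fin.sum_univ_two]
  simp only [Real.norm_eq_abs, sq_abs]
  gcongr
  exact mul_le_of_le_one_left (sq_nonneg _) hk1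

theorem norm_le_sqrt_div {k : ℝ} (hk0 : 0 < k) (hk1 : k ≤ 1) (x : EuclideanSpace ℝ (Fin 2)) :
    ‖x‖ ≤ √((x 0) ^ 2 + k * (x 1) ^ 2) / k := by
  rw [le_div_iff₀ hk0]
  apply Real.le_sqrt_of_sq_le
  rw [mul_pow, EuclideanSpace.norm_sq_eq, Fin.sum_univ_two]
  simp only [Real.norm_eq_abs, sq_abs]
  have hkk : k ^ 2 ≤ k := by nlinarith
  nlinarith [mul_le_mul_of_nonneg_right hkk (sq_nonneg (x 1)),
    mul_le_mul_of_nonneg_right (hkk.trans hk1) (sq_nonneg (x 0))]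

/-- Logarithmic-singularity estimate: for a bounded measurable
`Ω_b ⊂ ℝ²` and `ε ∈ (0,1)`, there is `C > 0` such that for all `y, z ∈ Ω_b`,
`∫_{Ω_b} |ln ρ(x-y) - ln ρ(x-z)|² dx ≤ C ‖y - z‖^{2-ε}`, where
`ρ(x) = √(x₁² + (1-M²)x₂²)/(1-M²)`. -/
theorem stmt_17 (M : ℝ) (hM0 : 0 ≤ M) (hM1 : M < 1)
    (ρ : EuclideanSpace ℝ (Fin 2) → ℝ)
    (hρ : ∀ x : EuclideanSpace ℝ (Fin 2),
      ρ x = Real.sqrt ((x 0) ^ 2 + (1 - M ^ 2) * (x 1) ^ 2) / (1 - M ^ 2))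
    (Ωb : Set (EuclideanSpace ℝ (Fin 2)))
    (hΩb : Bornology.IsBounded Ωb) (hΩm : MeasurableSet Ωb)
    (ε : ℝ) (hε0 : 0 < ε) (hε1 : ε < 1) :
    ∃ C > 0, ∀ y ∈ Ωb, ∀ z ∈ Ωb,
      (∫ x in Ωb, |Real.log (ρ (x - y)) - Real.log (ρ (x - z))| ^ 2)
        ≤ C * ‖y - z‖ ^ (2 - ε) := by
  have hk0 : 0 < 1 - M ^ 2 := by nlinarith
  have hk1 : 1 - M ^ 2 ≤ 1 := by nlinarith
  obtain ⟨R, hR⟩ := hΩb.subset_ball 0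
  set p := 2 - ε with hp
  set g : EuclideanSpace ℝ (Fin 2) → ℝ := (Metric.ball 0 (R + R)).indicator fun x => ‖x‖ ^ (-p)
  have hg : Integrable g := integrable_indicator_ball_norm_rpow_neg _ (by linarith)
  have hg0 : 0 ≤ g := Set.indicator_nonneg fun x _ => by positivity
  have hI : 0 ≤ ∫ x, g x := integral_nonneg hg0
  set K := 4 / p ^ 2 * ((1 - M ^ 2) ^ p)⁻¹ with hK
  have hK0 : 0 ≤ K := by positivity
  refine ⟨K * (2 * ∫ x, g x) + 1, by positivity, fun y hy z hz => ?_⟩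
  have hg_sub : ∀ w, ∀ x ∈ Ωb, w ∈ Ωb → g (x - w) = ‖x - w‖ ^ (-p) := by
    intro w x hx hw
    refine Set.indicator_of_mem ?_ _
    have h1 := hR hx
    have h2 := hR hw
    rw [mem_ball_zero_iff] at h1 h2 ⊢
    exact (norm_sub_le _ _).trans_lt (add_lt_add h1 h2)
  set G : EuclideanSpace ℝ (Fin 2) → ℝ :=
    fun x => K * ‖y - z‖ ^ p * (g (x - y) + g (x - z)) with hG
  have hGi : Integrable G := ((hg.comp_sub_right y).add (hg.comp_sub_right z)).const_mul _
  have hG0 : 0 ≤ G := fun x => mul_nonneg (by positivity) (add_nonneg (hg0 _) (hg0 _))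
  have hGint : ∫ x, G x = K * ‖y - z‖ ^ p * (2 * ∫ x, g x) := by
    rw [integral_const_mul, integral_add (hg.comp_sub_right y) (hg.comp_sub_right z),
      integral_sub_right_eq_self g, integral_sub_right_eq_self g, two_mul]
  have hne : ∀ w : EuclideanSpace ℝ (Fin 2), ∀ᵐ x ∂volume.restrict Ωb, x ≠ w := fun w =>
    ae_restrict_of_ae (compl_mem_ae_iff.mpr (measure_singleton w))
  calc _ ≤ ∫ x in Ωb, G x := by
        refine integral_mono_of_nonneg (.of_forall fun x => sq_nonneg _) hGi.integrableOn ?_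
        filter_upwards [ae_restrict_mem hΩm, hne y, hne z] with x hx hxy hxz
        have hdiff : |ρ (x - y) - ρ (x - z)| ≤ ‖y - z‖ / (1 - M ^ 2) := by
          have h := abs_sqrt_div_sub_sqrt_div_le hk0 hk1 (x - y) (x - z)
          rwa [← hρ, ← hρ, sub_sub_sub_cancel_left, norm_sub_rev] at h
        have h := Real.abs_log_sub_log_sq_le (norm_pos_iff.mpr (sub_ne_zero.mpr hxy))
          (norm_pos_iff.mpr (sub_ne_zero.mpr hxz)) (hρ (x - y) ▸ norm_le_sqrt_div hk0 hk1 _)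
          (hρ (x - z) ▸ norm_le_sqrt_div hk0 hk1 _) hdiff (p := p) (by linarith) (by linarith)
        rw [Real.div_rpow (norm_nonneg _) hk0.le] at h
        simp only [hG, hg_sub y x hx hy, hg_sub z x hx hz, hK]
        exact h.trans_eq (by ring)
    _ ≤ ∫ x, G x := setIntegral_le_integral hGi (.of_forall hG0)
    _ ≤ _ := by
        rw [hGint]
        nlinarith [Real.rpow_nonneg (norm_nonneg (y - z)) p]
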